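/- Let h, r : [0,1]² → [0,1] be graphons with 0 < r < 1 a.e., and let ε > 0. If d_□(h,r) ≥ ε then I_r(h) ≥ ε². Consequently, if δ_□(h,r) ≥ ε, then I_r(h^σ) ≥ ε² for every measure-preserving bijection σ of [0,1], so Ĩ_r(h̃) := inf_σ I_r(h^σ) ≥ ε². -/

import Mathlib

open MeasureTheory Filter
open scoped ENNReal

noncomputable section

/-- The unit square `[0,1]² ⊆ ℝ²`. -/
def unitSq : Set (ℝ × ℝ) := Set.Icc (0:ℝ) 1 ×ˢ Set.Icc (0:ℝ) 1

/-- A graphon: a symmetric measurable function `[0,1]² → [0,1]` (extended to `ℝ²`). -/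
def IsGraphon (h : ℝ → ℝ → ℝ) : Prop :=
  Measurable (Function.uncurry h) ∧ (∀ x y, h x y = h y x) ∧ ∀ x y, h x y ∈ Set.Icc (0:ℝ) 1

/-- The cut distance `d_□`. -/
def cutDist (h₁ h₂ : ℝ → ℝ → ℝ) : ℝ :=
  ⨆ S : {S : Set ℝ // MeasurableSet S ∧ S ⊆ Set.Icc 0 1},
    ⨆ T : {T : Set ℝ // MeasurableSet T ∧ T ⊆ Set.Icc 0 1},
      |∫ p in S.1 ×ˢ T.1, (h₁ p.1 p.2 - h₂ p.1 p.2)|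

/-- A measure-preserving bijection of `[0,1]`. -/
structure MPBij where
  toFun : ℝ → ℝ
  bijOn : Set.BijOn toFun (Set.Icc 0 1) (Set.Icc 0 1)
  mp : MeasurePreserving toFun (volume.restrict (Set.Icc 0 1)) (volume.restrict (Set.Icc 0 1))

instance : Nonempty MPBij := ⟨⟨id, Set.bijOn_id _, MeasurePreserving.id _⟩⟩

/-- Relabelling of a graphon: `h^σ(x,y) = h(σ x, σ y)`. -/
def relabel (σ : MPBij) (h : ℝ → ℝ → ℝ) : ℝ → ℝ → ℝ := fun x y => h (σ.toFun x) (σ.toFun y)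

/-- The cut metric `δ_□`. -/
def cutMetric (h₁ h₂ : ℝ → ℝ → ℝ) : ℝ :=
  ⨅ σ₁ : MPBij, ⨅ σ₂ : MPBij, cutDist (relabel σ₁ h₁) (relabel σ₂ h₂)

/-- `L¹` distance of (graphon-type) kernels over the unit square. -/
def L1dist (h₁ h₂ : ℝ → ℝ → ℝ) : ℝ := ∫ p in unitSq, |h₁ p.1 p.2 - h₂ p.1 p.2|

/-- Bernoulli relative entropy `R(a|b)`, with the conventions `0 log 0 = 0`,
`R(a|0) = ∞` for `a > 0`, `R(a|1) = ∞` for `a < 1`. -/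
def relEnt (a b : ℝ) : ℝ≥0∞ :=
  if b ≤ 0 then (if a ≤ 0 then 0 else ∞)
  else if 1 ≤ b then (if 1 ≤ a then 0 else ∞)
  else ENNReal.ofReal (a * Real.log (a / b) + (1 - a) * Real.log ((1 - a) / (1 - b)))

/-- The rate function `I_r(h) = ∫_{[0,1]²} R(h(x,y)|r(x,y)) dx dy`. -/
def Irate (r h : ℝ → ℝ → ℝ) : ℝ≥0∞ := ∫⁻ p in unitSq, relEnt (h p.1 p.2) (r p.1 p.2)

/-- `Ĩ_r(h̃) = inf_σ I_r(h^σ)`. -/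
def IrateTilde (r h : ℝ → ℝ → ℝ) : ℝ≥0∞ := ⨅ σ : MPBij, Irate r (relabel σ h)

end

noncomputable section

/-- A binary Pinsker-type inequality. -/
theorem sq_sub_le_binary_relEnt {a b : ℝ} (ha : a ∈ Set.Icc (0:ℝ) 1) (hb : b ∈ Set.Ioo (0:ℝ) 1) :
    (a - b) ^ 2 ≤ a * Real.log (a / b) + (1 - a) * Real.log ((1 - a) / (1 - b)) := by
  have key : ∀ {p q : ℝ}, 0 ≤ p → 0 < q → 2 * p - 2 * (√p * √q) ≤ p * Real.log (p / q) := by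
    intro p q hp hq
    rcases hp.eq_or_lt with rfl | hp
    · simp
    have hsp := Real.sqrt_pos.2 hp
    have hsq := Real.sqrt_pos.2 hq
    have h1 : Real.log (√q / √p) ≤ √q / √p - 1 := Real.log_le_sub_one_of_pos (by positivity)
    have h2 : Real.log (p / q) = -2 * Real.log (√q / √p) := by
      rw [Real.log_div hsq.ne' hsp.ne', Real.log_div hp.ne' hq.ne', Real.log_sqrt hp.le,
        Real.log_sqrt hq.le]
      ring
    have h3 : p * (√q / √p) = √p * √q := by
      nth_rewrite 1 [← Real.mul_self_sqrt hp.le]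
      field_simp
    rw [h2]
    nlinarith [mul_le_mul_of_nonneg_left h1 hp.le]
  have h1 := key ha.1 hb.1
  have h2 := key (sub_nonneg.2 ha.2) (sub_pos.2 hb.2)
  have hx := Real.sq_sqrt ha.1
  have hy := Real.sq_sqrt hb.1.le
  have hu := Real.sq_sqrt (sub_nonneg.2 ha.2)
  have hv := Real.sq_sqrt (sub_pos.2 hb.2).le
  set x := √a
  set y := √b
  set u := √(1 - a)
  set v := √(1 - b)
  have hxu : x ^ 2 + u ^ 2 = 1 := by linarith
  have hyv : y ^ 2 + v ^ 2 = 1 := by linarith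
  have hprod : (x ^ 2 + u ^ 2) * (y ^ 2 + v ^ 2) = 1 := by rw [hxu, hyv, one_mul]
  have hsum : (x * v + y * u) ^ 2 ≤ 1 := by nlinarith [sq_nonneg (x * y - u * v)]
  have hdiff : (x * v - y * u) ^ 2 = 1 - (x * y + u * v) ^ 2 := by linear_combination hprod
  have hab : a - b = (x * v - y * u) * (x * v + y * u) := by
    linear_combination -hx + hy + x ^ 2 * (-hyv) + y ^ 2 * hxu
  have hle : (a - b) ^ 2 ≤ (x * v - y * u) ^ 2 := by
    rw [hab, mul_pow]
    exact mul_le_of_le_one_right (sq_nonneg _) hsum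
  nlinarith [sq_nonneg (1 - (x * y + u * v))]

theorem ofReal_sq_sub_le_relEnt {a b : ℝ} (ha : a ∈ Set.Icc (0:ℝ) 1) (hb : b ∈ Set.Ioo (0:ℝ) 1) :
    ENNReal.ofReal ((a - b) ^ 2) ≤ relEnt a b := by
  rw [relEnt, if_neg hb.1.not_ge, if_neg hb.2.not_ge]
  exact ENNReal.ofReal_le_ofReal (sq_sub_le_binary_relEnt ha hb)

instance isProbabilityMeasure_restrict_unitSq :
    IsProbabilityMeasure ((volume : Measure (ℝ × ℝ)).restrict unitSq) :=
  ⟨by rw [Measure.restrict_apply_univ, unitSq, Measure.volume_eq_prod, Measure.prod_prod]; simp⟩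

theorem sq_integral_le_integral_sq {α : Type*} [MeasurableSpace α] {μ : Measure α}
    [IsProbabilityMeasure μ] {f : α → ℝ} (hf : Integrable f μ)
    (hf2 : Integrable (fun x => f x ^ 2) μ) : (∫ x, f x ∂μ) ^ 2 ≤ ∫ x, f x ^ 2 ∂μ := by
  set c := ∫ x, f x ∂μ with hc
  have h0 : 0 ≤ ∫ x, (f x - c) ^ 2 ∂μ := integral_nonneg fun x => sq_nonneg _
  have h1 : ∫ x, (f x - c) ^ 2 ∂μ = ∫ x, (f x ^ 2 - (2 * c) * f x + c ^ 2) ∂μ :=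
    integral_congr_ae (ae_of_all _ fun x => by ring)
  have h2 : Integrable (fun x => f x ^ 2 - (2 * c) * f x) μ := hf2.sub (hf.const_mul _)
  rw [h1, integral_add h2 (integrable_const _),
    integral_sub hf2 (hf.const_mul _), integral_const_mul, ← hc, integral_const, probReal_univ,
    one_smul] at h0
  linarith

theorem IsGraphon.abs_sub_le_one {h r : ℝ → ℝ → ℝ} (hh : IsGraphon h) (hr : IsGraphon r)
    (x y : ℝ) : |h x y - r x y| ≤ 1 := by
  have h1 := hh.2.2 x y
  have h2 := hr.2.2 x y
  exact abs_le.2 ⟨by linarith [h1.1, h2.2], by linarith [h1.2, h2.1]⟩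

theorem IsGraphon.measurable_sub {h r : ℝ → ℝ → ℝ} (hh : IsGraphon h) (hr : IsGraphon r) :
    Measurable fun p : ℝ × ℝ => h p.1 p.2 - r p.1 p.2 :=
  hh.1.sub hr.1

theorem IsGraphon.integrable_abs_sub {h r : ℝ → ℝ → ℝ} (hh : IsGraphon h) (hr : IsGraphon r) :
    Integrable (fun p : ℝ × ℝ => |h p.1 p.2 - r p.1 p.2|) (volume.restrict unitSq) := by
  refine Integrable.of_bound (hh.measurable_sub hr).abs.aestronglyMeasurable 1
    (ae_of_all _ fun p => ?_)
  rw [Real.norm_eq_abs, abs_abs]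
  exact hh.abs_sub_le_one hr _ _

theorem IsGraphon.integrable_sq_sub {h r : ℝ → ℝ → ℝ} (hh : IsGraphon h) (hr : IsGraphon r) :
    Integrable (fun p : ℝ × ℝ => (h p.1 p.2 - r p.1 p.2) ^ 2) (volume.restrict unitSq) := by
  refine Integrable.of_bound ((hh.measurable_sub hr).pow_const 2).aestronglyMeasurable 1
    (ae_of_all _ fun p => ?_)
  rw [norm_pow, Real.norm_eq_abs]
  exact pow_le_one₀ (abs_nonneg _) (hh.abs_sub_le_one hr _ _)

theorem IsGraphon.cutDist_le_L1dist {h r : ℝ → ℝ → ℝ} (hh : IsGraphon h) (hr : IsGraphon r) :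
    cutDist h r ≤ L1dist h r := by
  have : Nonempty {S : Set ℝ // MeasurableSet S ∧ S ⊆ Set.Icc 0 1} :=
    ⟨⟨∅, MeasurableSet.empty, Set.empty_subset _⟩⟩
  refine ciSup_le fun S => ciSup_le fun T => abs_integral_le_integral_abs.trans ?_
  exact setIntegral_mono_set (hh.integrable_abs_sub hr) (ae_of_all _ fun p => abs_nonneg _)
    (Set.prod_mono S.2.2 T.2.2).eventuallyLE

theorem IsGraphon.sq_L1dist_le_Irate {h r : ℝ → ℝ → ℝ} (hh : IsGraphon h) (hrg : IsGraphon r)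
    (hr : ∀ᵐ p ∂(volume.restrict unitSq), r p.1 p.2 ∈ Set.Ioo (0:ℝ) 1) :
    ENNReal.ofReal (L1dist h r ^ 2) ≤ Irate r h := by
  have hsq := hh.integrable_sq_sub hrg
  calc ENNReal.ofReal (L1dist h r ^ 2)
      ≤ ENNReal.ofReal (∫ p in unitSq, (h p.1 p.2 - r p.1 p.2) ^ 2) := by
        refine ENNReal.ofReal_le_ofReal ?_
        simpa only [L1dist, sq_abs] using sq_integral_le_integral_sq (hh.integrable_abs_sub hrg)
          (by simpa only [sq_abs] using hsq)
    _ = ∫⁻ p in unitSq, ENNReal.ofReal ((h p.1 p.2 - r p.1 p.2) ^ 2) :=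
        ofReal_integral_eq_lintegral_ofReal hsq (ae_of_all _ fun p => sq_nonneg _)
    _ ≤ Irate r h := lintegral_mono_ae <| hr.mono fun p hp =>
        ofReal_sq_sub_le_relEnt (hh.2.2 _ _) hp

theorem IsGraphon.ofReal_sq_le_Irate {h r : ℝ → ℝ → ℝ} (hh : IsGraphon h) (hrg : IsGraphon r)
    (hr : ∀ᵐ p ∂(volume.restrict unitSq), r p.1 p.2 ∈ Set.Ioo (0:ℝ) 1) {ε : ℝ} (hε : 0 ≤ ε)
    (hd : ε ≤ cutDist h r) : ENNReal.ofReal (ε ^ 2) ≤ Irate r h :=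
  (ENNReal.ofReal_le_ofReal (pow_le_pow_left₀ hε (hd.trans (hh.cutDist_le_L1dist hrg)) 2)).trans
    (hh.sq_L1dist_le_Irate hrg hr)

theorem IsGraphon.relabel {h : ℝ → ℝ → ℝ} (hh : IsGraphon h) (σ : MPBij) :
    IsGraphon (relabel σ h) :=
  ⟨hh.1.comp (σ.mp.measurable.prodMap σ.mp.measurable), fun _ _ => hh.2.1 _ _,
    fun _ _ => hh.2.2 _ _⟩

theorem cutDist_nonneg (h r : ℝ → ℝ → ℝ) : 0 ≤ cutDist h r :=
  Real.iSup_nonneg fun _ => Real.iSup_nonneg fun _ => abs_nonneg _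

theorem cutMetric_le_cutDist_relabel (h r : ℝ → ℝ → ℝ) (σ : MPBij) :
    cutMetric h r ≤ cutDist (relabel σ h) r := by
  have h1 : cutMetric h r ≤ ⨅ σ₂ : MPBij, cutDist (relabel σ h) (relabel σ₂ r) :=
    ciInf_le ⟨0, by rintro _ ⟨_, rfl⟩; exact Real.iInf_nonneg fun _ => cutDist_nonneg _ _⟩ σ
  exact h1.trans (ciInf_le ⟨0, by rintro _ ⟨_, rfl⟩; exact cutDist_nonneg _ _⟩
    (⟨id, Set.bijOn_id _, MeasurePreserving.id _⟩ : MPBij))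

/-- Graphons at cut distance at least `ε` from a reference graphon `r` (with `0 < r < 1` a.e.)
have rate at least `ε²`: if `d_□(h,r) ≥ ε` then `I_r(h) ≥ ε²`; consequently, if
`δ_□(h,r) ≥ ε` then `I_r(h^σ) ≥ ε²` for every measure-preserving bijection `σ`, whence
`Ĩ_r(h̃) ≥ ε²`. -/
theorem statement15
    (h r : ℝ → ℝ → ℝ) (hh : IsGraphon h) (hrg : IsGraphon r)
    (hr : ∀ᵐ p ∂(volume.restrict unitSq), r p.1 p.2 ∈ Set.Ioo (0:ℝ) 1)
    (ε : ℝ) (hε : 0 < ε) :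
    (ε ≤ cutDist h r → ENNReal.ofReal (ε ^ 2) ≤ Irate r h) ∧
    (ε ≤ cutMetric h r →
      (∀ σ : MPBij, ENNReal.ofReal (ε ^ 2) ≤ Irate r (relabel σ h)) ∧
      ENNReal.ofReal (ε ^ 2) ≤ IrateTilde r h) := by
  have hσ : ε ≤ cutMetric h r → ∀ σ : MPBij, ENNReal.ofReal (ε ^ 2) ≤ Irate r (relabel σ h) :=
    fun hd σ => (hh.relabel σ).ofReal_sq_le_Irate hrg hr hε.le
      (hd.trans (cutMetric_le_cutDist_relabel h r σ))
  exact ⟨hh.ofReal_sq_le_Irate hrg hr hε.le, fun hd => ⟨hσ hd, le_iInf (hσ hd)⟩⟩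

end
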